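/- arXiv:1206.5467 — 5 statements merged into one kernel-verified Lean document; each statement's English description precedes it below -/
import Mathlib

section
/- Let D be a finite oriented graph and let v₀ be a vertex of D that is adjacent (joined by an arc in one direction or the other) to every other vertex of D. Suppose the out-neighbourhood N⁺(v₀) and the in-neighbourhood N⁻(v₀) are both nonempty, and set a = min{d⁺(v) : v ∈ N⁺(v₀)} and b = min{d⁺(v) : v ∈ N⁻(v₀)}. If d⁺(v₀) ≤ a and 2·d⁺(v₀) ≤ a + b + 1, then there exist d⁺(v₀) pairwise arc-disjoint directed cycles each of which passes through v₀. -/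
/-- `c` is a directed cycle of the digraph with arc relation `A`:
a list of pairwise distinct vertices, of length at least 3, with consecutive
arcs present and a closing arc from the last vertex back to the first. -/
def IsCycle {V : Type*} (A : V → V → Prop) (c : List V) : Prop :=
  c.Nodup ∧ 3 ≤ c.length ∧ List.Chain' A c ∧
    ∀ h : c ≠ [], A (c.getLast h) (c.head h)

/-- The set of arcs of the cycle given by the list `c`. -/
def cycleArcs {V : Type*} [DecidableEq V] (c : List V) : Finset (V × V) :=
  (c.zip (c.rotate 1)).toFinset

/-- The out-degree of a vertex. -/
def outDeg {V : Type*} [Fintype V] (A : V → V → Prop) [DecidableRel A] (v : V) : ℕ :=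
  (Finset.univ.filter (fun u => A v u)).card

/-- A `{-1, 0, 1}`-valued circulation in the digraph `A`, recorded as an antisymmetric function:
`g x y` is the net flow from `x` to `y`. -/
structure IsCirculation {V : Type*} [Fintype V] (A : V → V → Prop) [DecidableRel A]
    (g : V → V → ℤ) : Prop where
  antisymm : ∀ x y, g y x = -g x y
  le_cap : ∀ x y, g x y ≤ if A x y then 1 else 0
  sum_eq_zero : ∀ x, ∑ y, g x y = 0

/-- Push one unit of flow along every pair of the list `L`. -/
def pushFlow {V : Type*} [DecidableEq V] (g : V → V → ℤ) (L : List (V × V)) (x y : V) : ℤ :=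
  g x y + L.count (x, y) - L.count (y, x)

section Lists

variable {V : Type*}

/-- Reachability is witnessed by a path without repeated vertices. -/
lemma exists_nodup_isChain_of_reflTransGen {r : V → V → Prop} {a b : V}
    (h : Relation.ReflTransGen r a b) :
    ∃ p : List V, (p ++ [b]).Nodup ∧ (p ++ [b]).IsChain r ∧ (p ++ [b]).head? = some a := by
  classical
  induction h using Relation.ReflTransGen.head_induction_on with
  | refl => exact ⟨[], by simp⟩
  | @head a c hac _ ih =>
    obtain ⟨p, hnd, hch, hhd⟩ := ih
    by_cases ha : a ∈ p
    · obtain ⟨s, t, rfl⟩ := List.append_of_mem ha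
      have hsuf : a :: t ++ [b] <:+ s ++ a :: t ++ [b] := ⟨s, by simp⟩
      exact ⟨a :: t, hnd.sublist hsuf.sublist, hch.suffix hsuf, by simp⟩
    · by_cases hab : a = b
      · exact ⟨[], by simp [hab]⟩
      · refine ⟨a :: p, ?_, ?_, by simp⟩
        · rw [List.cons_append, List.nodup_cons]
          exact ⟨by simp [ha, hab], hnd⟩
        · rw [List.cons_append, List.isChain_cons]
          refine ⟨fun y hy => ?_, hch⟩
          rw [hhd] at hy
          simp only [Option.mem_def, Option.some.injEq] at hy
          exact hy ▸ hac

/-- Either there is a simple path from `u` to `v`, or a set separating `u` from `v`. -/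
lemma exists_path_or_cut [Fintype V] (r : V → V → Prop) {u v : V} (huv : u ≠ v) :
    (∃ q : List V, (v :: u :: q).Nodup ∧ (u :: q ++ [v]).IsChain r) ∨
      ∃ S : Finset V, u ∈ S ∧ v ∉ S ∧ ∀ x ∈ S, ∀ y ∉ S, ¬ r x y := by
  classical
  by_cases h : Relation.ReflTransGen r u v
  · left
    obtain ⟨p, hnd, hch, hhd⟩ := exists_nodup_isChain_of_reflTransGen h
    cases p with
    | nil => simp_all
    | cons w q =>
      obtain rfl : w = u := by simpa using hhd
      refine ⟨q, ?_, hch⟩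
      rw [List.nodup_append_comm] at hnd
      exact hnd
  · right
    refine ⟨Finset.univ.filter (Relation.ReflTransGen r u), by simp [Relation.ReflTransGen.refl],
      by simpa using h, ?_⟩
    intro x hx y hy hxy
    simp only [Finset.mem_filter, Finset.mem_univ, true_and] at hx hy
    exact hy (hx.tail hxy)

lemma rel_of_mem_zip_of_isChain {r : V → V → Prop} {b x y : V} :
    ∀ (q : List V) (a : V), (a :: q ++ [b]).IsChain r →
      (x, y) ∈ (a :: q).zip (q ++ [b]) → r x y
  | [], a, h, hm => by simp_all
  | c :: q, a, h, hm => by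
    simp only [List.cons_append, List.isChain_cons_cons, List.zip_cons_cons, List.mem_cons,
      Prod.mk.injEq] at h hm
    rcases hm with ⟨rfl, rfl⟩ | hm
    · exact h.1
    · exact rel_of_mem_zip_of_isChain q c h.2 hm

lemma mem_zip_cycle_cases {r : V → V → Prop} {u v x y : V} {q : List V}
    (hnd : (v :: u :: q).Nodup) (hch : (u :: q ++ [v]).IsChain r)
    (hm : (x, y) ∈ (v :: u :: q).zip (u :: q ++ [v])) :
    (x = v ∧ y = u) ∨ (x ≠ v ∧ r x y) := by
  simp only [List.cons_append, List.zip_cons_cons, List.mem_cons, Prod.mk.injEq] at hm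
  rcases hm with h | hm
  · exact Or.inl h
  · refine Or.inr ⟨?_, rel_of_mem_zip_of_isChain q u hch (by simpa using hm)⟩
    rintro rfl
    exact (List.nodup_cons.1 hnd).1 (List.of_mem_zip hm).1

lemma nodup_zip_of_nodup_left {l m : List V} (hl : l.Nodup) : (l.zip m).Nodup := by
  induction l generalizing m with
  | nil => simp
  | cons a l ih =>
    cases m with
    | nil => simp
    | cons b m =>
      rw [List.nodup_cons] at hl
      rw [List.zip_cons_cons, List.nodup_cons]
      exact ⟨fun h => hl.1 (List.of_mem_zip h).1, ih hl.2⟩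

lemma zip_cycle_fst_perm_snd (v : V) (p : List V) :
    (((v :: p).zip (p ++ [v])).map Prod.fst).Perm (((v :: p).zip (p ++ [v])).map Prod.snd) := by
  rw [List.map_fst_zip (by simp), List.map_snd_zip (by simp)]
  exact (List.perm_append_singleton v p).symm

variable [DecidableEq V]

lemma cycleArcs_cons (v : V) (p : List V) :
    cycleArcs (v :: p) = ((v :: p).zip (p ++ [v])).toFinset := by
  simp [cycleArcs]

lemma sum_count_fst [Fintype V] (L : List (V × V)) (x : V) :
    ∑ y, L.count (x, y) = (L.map Prod.fst).count x := by
  induction L with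
  | nil => simp
  | cons a L ih =>
    obtain ⟨s, t⟩ := a
    by_cases h : s = x
    · simp [List.count_cons, Finset.sum_add_distrib, ih, h]
    · simp [ih, h]

lemma sum_count_snd [Fintype V] (L : List (V × V)) (x : V) :
    ∑ y, L.count (y, x) = (L.map Prod.snd).count x := by
  induction L with
  | nil => simp
  | cons a L ih =>
    obtain ⟨s, t⟩ := a
    by_cases h : t = x
    · simp [List.count_cons, Finset.sum_add_distrib, ih, h]
    · simp [ih, h]

end Lists

section Circulations

variable {V : Type*} {A : V → V → Prop} [DecidableRel A]

/-- An oriented graph on `S` has at most `|S| (|S| - 1) / 2` arcs. -/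
lemma two_mul_sum_arcs_le (hirr : ∀ x, ¬ A x x) (hasym : ∀ x y, A x y → ¬ A y x) (S : Finset V) :
    2 * ∑ x ∈ S, ∑ y ∈ S, (if A x y then (1 : ℤ) else 0) ≤ S.card * (S.card - 1) := by
  classical
  have h : ∑ x ∈ S, ∑ y ∈ S, ((if A x y then (1 : ℤ) else 0) + if A y x then 1 else 0) ≤
      ∑ x ∈ S, ∑ y ∈ S, (1 - if x = y then 1 else 0) := by
    refine Finset.sum_le_sum fun x _ => Finset.sum_le_sum fun y _ => ?_
    by_cases hxy : x = y
    · subst hxy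
      simp [hirr]
    · have := hasym x y
      split_ifs <;> simp_all
  simp only [Finset.sum_add_distrib, Finset.sum_sub_distrib] at h
  rw [Finset.sum_comm (f := fun x y => if A y x then (1 : ℤ) else 0)] at h
  simp only [Finset.sum_ite_eq, Finset.sum_const, nsmul_eq_mul, mul_one] at h
  rw [Finset.sum_congr rfl fun x hx => if_pos hx] at h
  simp only [Finset.sum_const, nsmul_eq_mul, mul_one] at h
  linarith

variable [Fintype V] {g : V → V → ℤ}

lemma IsCirculation.neg_one_le (hg : IsCirculation A g) (x y : V) : -1 ≤ g x y := by
  have h1 := hg.antisymm x y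
  have h2 := hg.le_cap y x
  split_ifs at h2 <;> lia

lemma IsCirculation.le_one (hg : IsCirculation A g) (x y : V) : g x y ≤ 1 := by
  have h2 := hg.le_cap x y
  split_ifs at h2 <;> lia

variable [DecidableEq V]

/-- Pushing flow along a balanced list of residual arcs yields a circulation. -/
lemma IsCirculation.push (hg : IsCirculation A g) {L : List (V × V)} (hL : L.Nodup)
    (hbal : (L.map Prod.fst).Perm (L.map Prod.snd))
    (hres : ∀ x y, (x, y) ∈ L → g x y < if A x y then 1 else 0) :
    IsCirculation A (pushFlow g L) where
  antisymm x y := by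
    have := hg.antisymm x y
    simp only [pushFlow]
    lia
  le_cap x y := by
    have h1 := hg.le_cap x y
    have h2 := List.nodup_iff_count_le_one.1 hL (x, y)
    simp only [pushFlow]
    by_cases hm : (x, y) ∈ L
    · have := hres x y hm
      lia
    · rw [List.count_eq_zero_of_not_mem hm]
      lia
  sum_eq_zero x := by
    simp only [pushFlow]
    rw [Finset.sum_sub_distrib, Finset.sum_add_distrib, hg.sum_eq_zero, ← Nat.cast_sum,
      ← Nat.cast_sum, sum_count_fst, sum_count_snd, hbal.count_eq]
    ring

lemma IsCirculation.sum_cut_eq_zero (hg : IsCirculation A g) (S : Finset V) :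
    ∑ x ∈ S, ∑ y ∈ Sᶜ, g x y = 0 := by
  have h1 : ∑ x ∈ S, ∑ y ∈ S, g x y = 0 := by
    have h : ∑ x ∈ S, ∑ y ∈ S, g x y = -∑ x ∈ S, ∑ y ∈ S, g x y := by
      conv_lhs => rw [Finset.sum_comm]
      simp only [← Finset.sum_neg_distrib]
      exact Finset.sum_congr rfl fun x _ => Finset.sum_congr rfl fun y _ => hg.antisymm x y
    lia
  have h2 : ∑ x ∈ S, (∑ y ∈ S, g x y + ∑ y ∈ Sᶜ, g x y) = 0 :=
    Finset.sum_eq_zero fun x _ => by rw [Finset.sum_add_sum_compl, hg.sum_eq_zero]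
  rw [Finset.sum_add_distrib] at h2
  lia

/-- A circulation saturating arcs out of `v` contains arc-disjoint cycles through these arcs. -/
lemma IsCirculation.exists_cycles (hirr : ∀ x, ¬ A x x) (hasym : ∀ x y, A x y → ¬ A y x) (v : V)
    (T : Finset V) : ∀ g : V → V → ℤ, IsCirculation A g → (∀ y ∈ T, g v y = 1) →
      ∃ C : V → List V,
        (∀ y ∈ T, IsCycle A (C y) ∧ v ∈ C y ∧ ∀ x z, (x, z) ∈ cycleArcs (C y) → g x z = 1) ∧
        ∀ y ∈ T, ∀ z ∈ T, y ≠ z → Disjoint (cycleArcs (C y)) (cycleArcs (C z)) := by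
  induction T using Finset.induction_on with
  | empty => exact fun g _ _ => ⟨fun _ => [], by simp⟩
  | insert u T huT ih =>
    intro g hg hsat
    have hvu : g v u = 1 := hsat u (Finset.mem_insert_self u T)
    have harc : ∀ x y, g x y = 1 → A x y := by
      intro x y h
      have := hg.le_cap x y
      by_contra hA
      simp [hA] at this
      lia
    have hne : u ≠ v := by
      rintro rfl
      exact hirr u (harc u u hvu)
    rcases exists_path_or_cut (fun x y => g x y = 1) hne with ⟨q, hnd, hch⟩ | ⟨S, huS, hvS, hS⟩
    · set L := (v :: u :: q).zip (u :: q ++ [v]) with hLdef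
      have hLg : ∀ x y, (x, y) ∈ L → g x y = 1 := by
        intro x y hm
        rcases mem_zip_cycle_cases hnd hch hm with ⟨rfl, rfl⟩ | h
        exacts [hvu, h.2]
      have hLnd : L.Nodup := nodup_zip_of_nodup_left hnd
      have hg' : IsCirculation A (pushFlow g (L.map Prod.swap)) := by
        refine hg.push (hLnd.map Prod.swap_injective) ?_ ?_
        · rw [List.map_map, List.map_map]
          exact (zip_cycle_fst_perm_snd v (u :: q)).symm
        · intro x y hm
          have h1 : g y x = 1 := hLg y x (by simpa using hm)
          have h2 := hg.antisymm x y
          split_ifs <;> lia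
      have hcount : ∀ x y, (L.map Prod.swap).count (x, y) = L.count (y, x) := fun x y =>
        List.count_map_of_injective L Prod.swap Prod.swap_injective (y, x)
      have hpush : ∀ x y, pushFlow g (L.map Prod.swap) x y = 1 ↔ g x y = 1 ∧ (x, y) ∉ L := by
        intro x y
        simp only [pushFlow, hcount]
        have h1 := List.nodup_iff_count_le_one.1 hLnd (x, y)
        have h2 := List.nodup_iff_count_le_one.1 hLnd (y, x)
        have h3 := hg.antisymm x y
        have h4 : 0 < L.count (x, y) ↔ (x, y) ∈ L := List.count_pos_iff
        have h5 : 0 < L.count (y, x) ↔ (y, x) ∈ L := List.count_pos_iff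
        have h6 := hLg x y
        have h7 := hLg y x
        by_cases m1 : (x, y) ∈ L <;> by_cases m2 : (y, x) ∈ L <;> simp only [m1, m2] at * <;> lia
      obtain ⟨C, hC, hdis⟩ := ih _ hg' (by
        intro y hy
        refine (hpush v y).2 ⟨hsat y (Finset.mem_insert_of_mem hy), fun hm => ?_⟩
        rcases mem_zip_cycle_cases hnd hch hm with h | h
        · exact huT (h.2 ▸ hy)
        · exact h.1 rfl)
      have hdisL : ∀ y ∈ T, Disjoint (cycleArcs (v :: u :: q)) (cycleArcs (C y)) := by
        intro y hy
        rw [Finset.disjoint_left]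
        rintro ⟨x, z⟩ h1 h2
        rw [cycleArcs_cons, List.mem_toFinset] at h1
        exact ((hpush x z).1 ((hC y hy).2.2 x z h2)).2 h1
      have hchA : (u :: q ++ [v]).IsChain A := hch.imp fun x y => harc x y
      refine ⟨Function.update C u (v :: u :: q), ?_, ?_⟩
      · intro y hy
        by_cases hyu : y = u
        · subst hyu
          rw [Function.update_self]
          have hlast : A ((y :: q).getLast (by simp)) v :=
            (List.isChain_append.1 hchA).2.2 _ (List.getLast_mem_getLast? _) _ (by simp)
          refine ⟨⟨hnd, ?_, ?_, ?_⟩, by simp, ?_⟩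
          · cases q with
            | nil => exact absurd (by simpa using hlast) (hasym _ _ (harc _ _ hvu))
            | cons => simp
          · exact List.isChain_cons_cons.2 ⟨harc _ _ hvu, hchA.left_of_append⟩
          · intro _
            simpa using hlast
          · intro x z hm
            rw [cycleArcs_cons, List.mem_toFinset] at hm
            exact hLg x z hm
        · rw [Function.update_of_ne hyu]
          have hyT := (Finset.mem_insert.1 hy).resolve_left hyu
          obtain ⟨h1, h2, h3⟩ := hC y hyT
          exact ⟨h1, h2, fun x z hm => ((hpush x z).1 (h3 x z hm)).1⟩
      · intro y hy z hz hyz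
        rw [Finset.mem_insert] at hy hz
        by_cases hyu : y = u
        · have hzu : z ≠ u := fun h => hyz (hyu.trans h.symm)
          rw [hyu, Function.update_self, Function.update_of_ne hzu]
          exact hdisL z (hz.resolve_left hzu)
        · rw [Function.update_of_ne hyu]
          by_cases hzu : z = u
          · rw [hzu, Function.update_self]
            exact (hdisL y (hy.resolve_left hyu)).symm
          · rw [Function.update_of_ne hzu]
            exact hdis y (hy.resolve_left hyu) z (hz.resolve_left hzu) hyz
    · exfalso
      have hle : ∀ x ∈ S, ∀ y ∈ Sᶜ, g x y ≤ 0 := by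
        intro x hx y hy
        have h1 := hS x hx y (Finset.mem_compl.1 hy)
        have h2 := hg.le_one x y
        lia
      have hlt : ∑ x ∈ S, ∑ y ∈ Sᶜ, g x y < ∑ x ∈ S, (0 : ℤ) := by
        refine Finset.sum_lt_sum (fun x hx => Finset.sum_nonpos (hle x hx)) ⟨u, huS, ?_⟩
        refine Finset.sum_neg' (hle u huS) ⟨v, Finset.mem_compl.2 hvS, ?_⟩
        rw [hg.antisymm v u, hvu]
        norm_num
      rw [hg.sum_cut_eq_zero] at hlt
      simp at hlt

/-- If every cut has enough capacity, some circulation saturates all arcs out of `v`. -/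
lemma exists_isCirculation_saturating (hirr : ∀ x, ¬ A x x) (hasym : ∀ x y, A x y → ¬ A y x)
    (v : V) (hadj : ∀ u, u ≠ v → A v u ∨ A u v)
    (hcut : ∀ S : Finset V, v ∉ S →
      ((S.filter (A v)).card : ℤ) ≤ ∑ x ∈ S, ∑ y ∈ Sᶜ, if A x y then 1 else 0)
    (T : Finset V) (hT : ∀ y ∈ T, A v y) :
    ∃ g : V → V → ℤ, IsCirculation A g ∧ ∀ y ∈ T, g v y = 1 := by
  induction T using Finset.induction_on with
  | empty =>
    refine ⟨fun _ _ => 0, ⟨by simp, fun x y => ?_, by simp⟩, by simp⟩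
    split_ifs <;> simp
  | insert u T huT ih =>
    obtain ⟨g, hg, hsat⟩ := ih fun y hy => hT y (Finset.mem_insert_of_mem hy)
    have hvu : A v u := hT u (Finset.mem_insert_self u T)
    have hne : u ≠ v := by
      rintro rfl
      exact hirr u hvu
    by_cases hgu : g v u = 1
    · refine ⟨g, hg, fun y hy => ?_⟩
      rcases Finset.mem_insert.1 hy with rfl | hy
      exacts [hgu, hsat y hy]
    have hgu0 : g v u ≤ 0 := by
      have := hg.le_one v u
      lia
    rcases exists_path_or_cut
        (fun x y => g x y < (if A x y then 1 else 0) ∧ (y = v → A x v)) hne with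
      ⟨q, hnd, hch⟩ | ⟨S, huS, hvS, hS⟩
    · set L := (v :: u :: q).zip (u :: q ++ [v]) with hLdef
      have hLnd : L.Nodup := nodup_zip_of_nodup_left hnd
      have hg' : IsCirculation A (pushFlow g L) := by
        refine hg.push hLnd (zip_cycle_fst_perm_snd v (u :: q)) fun x y hm => ?_
        rcases mem_zip_cycle_cases hnd hch hm with ⟨rfl, rfl⟩ | h
        · rw [if_pos hvu]
          lia
        · exact h.2.1
      have hin : ∀ y, A v y → L.count (y, v) = 0 := by
        intro y hy
        refine List.count_eq_zero_of_not_mem fun hm => ?_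
        rcases mem_zip_cycle_cases hnd hch hm with h | h
        · exact hne h.2.symm
        · exact hasym _ _ hy (h.2.2 rfl)
      refine ⟨_, hg', fun y hy => ?_⟩
      have h1 := hin y (hT y hy)
      have h2 := hg'.le_one v y
      simp only [pushFlow, h1] at h2 ⊢
      rcases Finset.mem_insert.1 hy with rfl | hy
      · have h3 : 0 < L.count (v, y) := List.count_pos_iff.2 (by simp [hLdef])
        have h4 := hg.antisymm v y
        have h5 := hg.le_cap y v
        rw [if_neg (hasym _ _ hvu)] at h5
        lia
      · have := hsat y hy
        lia
    · exfalso
      have hrow : ∀ x ∈ S, ∑ y ∈ Sᶜ, ((if A x y then 1 else 0) - g x y) ≤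
          if A v x ∧ x ≠ u then 1 else 0 := by
        intro x hx
        have hxv : x ≠ v := fun h => hvS (h ▸ hx)
        rw [Finset.sum_eq_single_of_mem v (Finset.mem_compl.2 hvS)]
        · have h1 := hg.neg_one_le x v
          have h2 := hg.antisymm v x
          have h3 := hS x hx v hvS
          by_cases hxu : x = u
          · subst hxu
            rw [if_neg (hasym _ _ hvu)]
            simp only [ne_eq, not_true_eq_false, and_false, if_false]
            lia
          · rcases hadj x hxv with h | h
            · rw [if_neg (hasym _ _ h), if_pos ⟨h, hxu⟩]
              lia
            · simp only [h, if_true, implies_true, and_true] at h3 ⊢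
              split_ifs <;> lia
        · intro y hy hyv
          have h1 := hS x hx y (Finset.mem_compl.1 hy)
          have h2 := hg.le_cap x y
          simp only [hyv, false_implies, and_true] at h1
          lia
      have h1 := Finset.sum_le_sum hrow
      simp only [Finset.sum_sub_distrib] at h1
      rw [hg.sum_cut_eq_zero, ← Finset.sum_filter, Finset.sum_const, nsmul_one, sub_zero] at h1
      have h2 := hcut S hvS
      have h3 : (S.filter fun x => A v x ∧ x ≠ u).card < (S.filter (A v)).card := by
        refine Finset.card_lt_card (Finset.ssubset_iff_of_subset ?_ |>.2 ⟨u, ?_, ?_⟩)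
        · intro x
          simp only [Finset.mem_filter]
          tauto
        · simp [huS, hvu]
        · simp
      lia

/-- The degree conditions bound the capacity of every cut avoiding `v`. -/
lemma card_filter_le_cut (hirr : ∀ x, ¬ A x x) (hasym : ∀ x y, A x y → ¬ A y x)
    (v : V) (hadj : ∀ u, u ≠ v → A v u ∨ A u v) (a b : ℕ)
    (ha : ∀ u, A v u → a ≤ outDeg A u) (hb : ∀ u, A u v → b ≤ outDeg A u)
    (h1 : outDeg A v ≤ a) (h2 : 2 * outDeg A v ≤ a + b + 1) (S : Finset V) (hv : v ∉ S) :
    ((S.filter (A v)).card : ℤ) ≤ ∑ x ∈ S, ∑ y ∈ Sᶜ, if A x y then 1 else 0 := by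
  set p := (S.filter (A v)).card with hp
  set q := (S.filter fun x => ¬ A v x).card with hq
  have hin : ∀ x ∈ S, ¬ A v x → A x v := fun x hx h =>
    (hadj x fun h' => hv (h' ▸ hx)).resolve_left h
  have hcard : p + q = S.card := Finset.card_filter_add_card_filter_not _
  have hqcut : (q : ℤ) ≤ ∑ x ∈ S, ∑ y ∈ Sᶜ, if A x y then 1 else 0 := by
    rw [hq, Finset.natCast_card_filter]
    refine Finset.sum_le_sum fun x hx => ?_
    refine le_trans ?_ (Finset.single_le_sum (f := fun y => if A x y then (1 : ℤ) else 0)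
      (fun y _ => by split_ifs <;> simp) (Finset.mem_compl.2 hv))
    have := hin x hx
    split_ifs <;> simp_all
  rcases le_or_gt p q with hpq | hpq
  · exact le_trans (by exact_mod_cast hpq) hqcut
  have hdeg : (p : ℤ) * a + q * b ≤ ∑ x ∈ S, (outDeg A x : ℤ) := by
    rw [← Finset.sum_filter_add_sum_filter_not S (A v)]
    refine add_le_add ?_ ?_
    · rw [hp, ← nsmul_eq_mul]
      refine Finset.card_nsmul_le_sum _ _ _ fun x hx => ?_
      exact_mod_cast ha x (Finset.mem_filter.1 hx).2
    · rw [hq, ← nsmul_eq_mul]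
      refine Finset.card_nsmul_le_sum _ _ _ fun x hx => ?_
      obtain ⟨hx1, hx2⟩ := Finset.mem_filter.1 hx
      exact_mod_cast hb x (hin x hx1 hx2)
  have hsplit : ∑ x ∈ S, (outDeg A x : ℤ) =
      ∑ x ∈ S, ∑ y ∈ S, (if A x y then (1 : ℤ) else 0) +
        ∑ x ∈ S, ∑ y ∈ Sᶜ, if A x y then (1 : ℤ) else 0 := by
    rw [← Finset.sum_add_distrib]
    refine Finset.sum_congr rfl fun x _ => ?_
    rw [Finset.sum_add_sum_compl, outDeg, Finset.natCast_card_filter]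
  have hinner := two_mul_sum_arcs_le hirr hasym S
  have hpk : p ≤ outDeg A v :=
    Finset.card_le_card (Finset.filter_subset_filter _ (Finset.subset_univ S))
  rw [← hcard] at hinner
  push_cast at hinner
  have hap : (p : ℤ) ≤ a := by exact_mod_cast hpk.trans h1
  have hab : 2 * (p : ℤ) ≤ a + b + 1 := by exact_mod_cast (Nat.mul_le_mul_left 2 hpk).trans h2
  have hqp : (q : ℤ) + 1 ≤ p := by exact_mod_cast hpq
  have hq0 : (0 : ℤ) ≤ q := by positivity
  have k1 := mul_nonneg (sub_nonneg.2 hap) (sub_nonneg.2 (show (q : ℤ) ≤ p by linarith))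
  have k2 := mul_nonneg (sub_nonneg.2 hab) hq0
  have k3 := mul_nonneg (sub_nonneg.2 hqp) (show (0 : ℤ) ≤ p + q by linarith)
  linarith

end Circulations

/-- Theorem 2.1: in a finite oriented graph, if `v₀` is adjacent to all other
vertices, `a = min {d⁺(v) : v ∈ N⁺(v₀)}`, `b = min {d⁺(v) : v ∈ N⁻(v₀)}`, and
`d⁺(v₀) ≤ min (a, (a+b+1)/2)`, then `v₀` belongs to `d⁺(v₀)` arc-disjoint cycles. -/
theorem arc_disjoint_cycles_through_vertex {V : Type*} [Fintype V] [DecidableEq V]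
    (A : V → V → Prop) [DecidableRel A]
    (hirr : ∀ x, ¬ A x x)
    (hasym : ∀ x y, A x y → ¬ A y x)
    (v0 : V)
    (hadj : ∀ u, u ≠ v0 → A v0 u ∨ A u v0)
    (a b : ℕ)
    (ha_mem : ∃ v, A v0 v ∧ outDeg A v = a)
    (ha_min : ∀ v, A v0 v → a ≤ outDeg A v)
    (hb_mem : ∃ v, A v v0 ∧ outDeg A v = b)
    (hb_min : ∀ v, A v v0 → b ≤ outDeg A v)
    (h1 : outDeg A v0 ≤ a)
    (h2 : 2 * outDeg A v0 ≤ a + b + 1) :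
    ∃ C : Fin (outDeg A v0) → List V,
      (∀ i, IsCycle A (C i) ∧ v0 ∈ C i) ∧
      ∀ i j, i ≠ j → Disjoint (cycleArcs (C i)) (cycleArcs (C j)) := by
  obtain ⟨g, hg, hsat⟩ := exists_isCirculation_saturating hirr hasym v0 hadj
    (card_filter_le_cut hirr hasym v0 hadj a b ha_min hb_min h1 h2)
    (Finset.univ.filter fun u => A v0 u) (by simp)
  obtain ⟨C, hC, hdis⟩ := IsCirculation.exists_cycles hirr hasym v0 _ g hg hsat
  let e := (Finset.univ.filter fun u => A v0 u).equivFin.symm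
  refine ⟨fun i => C (e i), fun i => ?_, fun i j hij => ?_⟩
  · obtain ⟨h, h', -⟩ := hC _ (e i).2
    exact ⟨h, h'⟩
  · exact hdis _ (e i).2 _ (e j).2 fun h => hij (e.injective (Subtype.ext h))
end

section
/- There exists a finite tournament T together with a minimum feedback arc set S of T (|S| = τ(T)) such that the digraph on the vertex set of T whose arc set is S is acyclic and contains a Hamiltonian directed path, and yet ν(T) < τ(T). (This answers Isaak's question, Problem 15.4.2 of Bang-Jensen–Gutin, in the negative.) -/
/-- `S` is a feedback arc set: a set of arcs whose removal leaves an acyclic digraph. -/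
def IsFeedbackArcSet {V : Type*} (A : V → V → Prop) (S : Finset (V × V)) : Prop :=
  (∀ e ∈ S, A e.1 e.2) ∧
    ∀ c : List V, ¬ IsCycle (fun x y => A x y ∧ (x, y) ∉ S) c

/-- `τ(D)`: the minimum size of a feedback arc set. -/
noncomputable def tau {V : Type*} (A : V → V → Prop) : ℕ :=
  sInf {n | ∃ S : Finset (V × V), IsFeedbackArcSet A S ∧ S.card = n}

/-- `ν(D)`: the maximum number of pairwise arc-disjoint directed cycles. -/
noncomputable def nu {V : Type*} [DecidableEq V] (A : V → V → Prop) : ℕ :=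
  sSup {n | ∃ C : Fin n → List V, (∀ i, IsCycle A (C i)) ∧
    ∀ i j, i ≠ j → Disjoint (cycleArcs (C i)) (cycleArcs (C j))}

/-- The consecutive pairs of a directed cycle, including the closing one, are arcs. -/
theorem IsCycle.rel_of_mem_cycleArcs {V : Type*} [DecidableEq V] {A : V → V → Prop} {c : List V}
    (h : IsCycle A c) {e : V × V} (he : e ∈ cycleArcs c) : A e.1 e.2 := by
  obtain ⟨-, -, hchain, hclose⟩ := h
  obtain ⟨i, hi, rfl⟩ := List.getElem_of_mem (List.mem_toFinset.1 he)
  have hi' : i < c.length := by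
    simp only [List.length_zip, List.length_rotate, min_self] at hi
    exact hi
  simp only [List.getElem_zip, List.getElem_rotate]
  by_cases hlast : i + 1 < c.length
  · simpa only [Nat.mod_eq_of_lt hlast] using List.isChain_iff_getElem.1 hchain i hlast
  · obtain rfl : i = c.length - 1 := by omega
    have hne : c ≠ [] := List.ne_nil_of_length_pos (by omega)
    have hfirst := hclose hne
    rw [List.getLast_eq_getElem, List.head_eq_getElem] at hfirst
    simpa only [Nat.sub_add_cancel (by omega : 1 ≤ c.length), Nat.mod_self] using hfirst

/-- A digraph whose relation holds on all the arcs of a cycle has that cycle. -/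
theorem IsCycle.of_forall_mem_cycleArcs {V : Type*} [DecidableEq V] {A B : V → V → Prop}
    {c : List V} (h : IsCycle A c) (hB : ∀ e ∈ cycleArcs c, B e.1 e.2) : IsCycle B c := by
  have hstep (i : ℕ) (hi : i < c.length) :
      B (c.get ⟨i, hi⟩) (c.get ⟨(i + 1) % c.length, Nat.mod_lt _ (by omega)⟩) := by
    refine hB (_, _) (List.mem_toFinset.2 (List.mem_iff_getElem.2 ⟨i, ?_, ?_⟩))
    · simpa only [List.length_zip, List.length_rotate, min_self] using hi
    · simp only [List.getElem_zip, List.getElem_rotate, List.get_eq_getElem]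
  obtain ⟨hnodup, hlen, -, -⟩ := h
  refine ⟨hnodup, hlen, List.isChain_iff_getElem.2 fun i hi => ?_, fun hne => ?_⟩
  · simpa only [List.get_eq_getElem, Nat.mod_eq_of_lt hi] using hstep i (by omega)
  · have hwrap := hstep (c.length - 1) (by omega)
    rw [List.getLast_eq_getElem, List.head_eq_getElem]
    simpa only [List.get_eq_getElem, Nat.sub_add_cancel (by omega : 1 ≤ c.length), Nat.mod_self]
      using hwrap

/-- A digraph along whose arcs some function strictly increases is acyclic. -/
theorem not_isCycle_of_lt {V : Type*} {A : V → V → Prop} (f : V → ℕ)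
    (hf : ∀ x y, A x y → f x < f y) (c : List V) : ¬ IsCycle A c := by
  rintro ⟨-, hlen, hchain, hclose⟩
  have hne : c ≠ [] := List.ne_nil_of_length_pos (by omega)
  have hsorted : (c.map f).Pairwise (· < ·) :=
    List.isChain_iff_pairwise.1 ((List.isChain_map f).2 (hchain.imp hf))
  have hlt := hf _ _ (hclose hne)
  rw [List.getLast_eq_getElem, List.head_eq_getElem] at hlt
  have hgt := List.pairwise_iff_getElem.1 hsorted 0 (c.length - 1)
    (by simp; omega) (by simp; omega) (by omega)
  simp only [List.getElem_map] at hgt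
  omega

/-- A feedback arc set meets every directed cycle. -/
theorem IsFeedbackArcSet.inter_cycleArcs_nonempty {V : Type*} [DecidableEq V] {A : V → V → Prop}
    {S : Finset (V × V)} (hS : IsFeedbackArcSet A S) {c : List V} (hc : IsCycle A c) :
    (S ∩ cycleArcs c).Nonempty := by
  by_contra hempty
  refine hS.2 c (hc.of_forall_mem_cycleArcs fun e he =>
    ⟨hc.rel_of_mem_cycleArcs he, fun heS => hempty ⟨e, Finset.mem_inter.2 ⟨heS, he⟩⟩⟩)

/-- If every arc lies on at most `k` of `m` given cycles, a feedback arc set has at least `m / k`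
arcs. -/
theorem IsFeedbackArcSet.le_mul_card {V : Type*} [DecidableEq V] {A : V → V → Prop}
    {S : Finset (V × V)} (hS : IsFeedbackArcSet A S) {m k : ℕ} (C : Fin m → List V)
    (hC : ∀ i, IsCycle A (C i))
    (hk : ∀ e, (Finset.univ.filter fun i => e ∈ cycleArcs (C i)).card ≤ k) :
    m ≤ k * S.card := by
  calc m = ∑ _i : Fin m, 1 := by simp
    _ ≤ ∑ i, (S.filter fun e => e ∈ cycleArcs (C i)).card := Finset.sum_le_sum fun i _ => by
        rw [Finset.filter_mem_eq_inter]
        exact (hS.inter_cycleArcs_nonempty (hC i)).card_pos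
    _ = ∑ e ∈ S, (Finset.univ.filter fun i => e ∈ cycleArcs (C i)).card :=
        (Finset.sum_card_bipartiteAbove_eq_sum_card_bipartiteBelow _).symm
    _ ≤ ∑ _e ∈ S, k := Finset.sum_le_sum fun e _ => hk e
    _ = k * S.card := by rw [Finset.sum_const, smul_eq_mul, mul_comm]

/-- If every cycle has at least `k` arcs in `W`, then `n` arc-disjoint cycles have at least
`k * n` arcs in `W`. -/
theorem mul_le_card_of_disjoint_cycleArcs {V : Type*} [DecidableEq V] {A : V → V → Prop}
    {W : Finset (V × V)} {k n : ℕ} (hW : ∀ c, IsCycle A c → k ≤ (cycleArcs c ∩ W).card)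
    (C : Fin n → List V) (hC : ∀ i, IsCycle A (C i))
    (hdisj : ∀ i j, i ≠ j → Disjoint (cycleArcs (C i)) (cycleArcs (C j))) :
    k * n ≤ W.card := by
  calc k * n = ∑ _i : Fin n, k := by simp [mul_comm]
    _ ≤ ∑ i, (cycleArcs (C i) ∩ W).card := Finset.sum_le_sum fun i _ => hW _ (hC i)
    _ = (Finset.univ.biUnion fun i => cycleArcs (C i) ∩ W).card :=
        (Finset.card_biUnion fun i _ j _ hij =>
          (hdisj i j hij).mono Finset.inter_subset_left Finset.inter_subset_left).symm
    _ ≤ W.card := Finset.card_le_card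
        (Finset.biUnion_subset.2 fun _ _ => Finset.inter_subset_right)

/-- If for every `w ∈ W` the arcs outside `W`, together with `w`, form an acyclic digraph, then
every cycle has at least two arcs in `W`. -/
theorem IsCycle.two_le_card_inter {V : Type*} [DecidableEq V] {A : V → V → Prop}
    {W : Finset (V × V)} (hne : W.Nonempty)
    (hW : ∀ w ∈ W, ∀ c, ¬ IsCycle (fun x y => A x y ∧ ((x, y) ∈ W → (x, y) = w)) c)
    {c : List V} (hc : IsCycle A c) : 2 ≤ (cycleArcs c ∩ W).card := by
  by_contra! hlt
  obtain ⟨w, hw, hsub⟩ : ∃ w ∈ W, ∀ e ∈ cycleArcs c ∩ W, e = w := by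
    rcases (cycleArcs c ∩ W).eq_empty_or_nonempty with hempty | ⟨w, hw⟩
    · exact hne.imp fun w hw => ⟨hw, by simp [hempty]⟩
    · exact ⟨w, (Finset.mem_inter.1 hw).2, fun e he =>
        Finset.card_le_one.1 (by omega) e he w hw⟩
  exact hW w hw c (hc.of_forall_mem_cycleArcs fun e he =>
    ⟨hc.rel_of_mem_cycleArcs he, fun heW => hsub e (Finset.mem_inter.2 ⟨he, heW⟩)⟩)

namespace IsaakTournament

/-- The backward arcs of the tournament. -/
def backArcs : Finset (Fin 10 × Fin 10) :=
  {(3, 0), (5, 0), (5, 3), (7, 0), (7, 5), (9, 0), (9, 3), (9, 7)}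

/-- The tournament on ten vertices obtained from the natural order by reversing the pairs in
`backArcs`. -/
def adj (x y : Fin 10) : Bool :=
  decide ((x, y) ∈ backArcs ∨ x < y ∧ (y, x) ∉ backArcs)

/-- Fifteen cycles covering each arc at most twice. -/
def cyclePacking : Fin 15 → List (Fin 10) :=
  ![[0, 2, 3], [0, 2, 3], [0, 1, 2, 5], [0, 1, 2, 5], [3, 4, 5], [3, 4, 5], [5, 9, 7],
    [0, 6, 7], [0, 6, 9], [3, 6, 8, 9], [0, 4, 7], [7, 8, 9], [5, 6, 7], [3, 6, 9], [0, 4, 9]]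

/-- Fifteen arcs, at least two of which lie on every cycle. -/
def doubleTransversal : Finset (Fin 10 × Fin 10) :=
  backArcs ∪ {(0, 1), (0, 2), (0, 4), (3, 4), (6, 7), (6, 9), (8, 9)}

/-- Three vertex orderings, each placing only arcs of `doubleTransversal` backwards; every arc of
`doubleTransversal` is forwards in one of them. -/
def ranking : Fin 3 → Fin 10 → ℕ :=
  ![![0, 1, 2, 3, 4, 5, 6, 7, 8, 9], ![0, 1, 2, 3, 4, 6, 7, 5, 8, 9],
    ![7, 0, 1, 5, 2, 3, 8, 6, 9, 4]]

theorem isCycle_cyclePacking (i : Fin 15) :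
    IsCycle (fun x y => adj x y = true) (cyclePacking i) := by
  unfold IsCycle List.Chain'
  revert i
  decide +kernel

theorem card_filter_mem_cyclePacking_le (e : Fin 10 × Fin 10) :
    (Finset.univ.filter fun i => e ∈ cycleArcs (cyclePacking i)).card ≤ 2 := by
  revert e
  decide +kernel

theorem two_le_card_inter_doubleTransversal (c : List (Fin 10))
    (hc : IsCycle (fun x y => adj x y = true) c) :
    2 ≤ (cycleArcs c ∩ doubleTransversal).card := by
  refine hc.two_le_card_inter (by decide) fun w hw => ?_
  have hrank : ∀ w ∈ doubleTransversal, ∃ i, ∀ x y,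
      adj x y = true ∧ ((x, y) ∈ doubleTransversal → (x, y) = w) →
        ranking i x < ranking i y := by
    decide +kernel
  obtain ⟨i, hi⟩ := hrank w hw
  exact not_isCycle_of_lt (ranking i) hi

theorem isFeedbackArcSet_backArcs : IsFeedbackArcSet (fun x y => adj x y = true) backArcs :=
  ⟨by decide +kernel, not_isCycle_of_lt Fin.val (by decide +kernel)⟩

theorem tau_eq : tau (fun x y => adj x y = true) = 8 := by
  refine le_antisymm (Nat.sInf_le ⟨backArcs, isFeedbackArcSet_backArcs, rfl⟩)
    (le_csInf ⟨8, backArcs, isFeedbackArcSet_backArcs, rfl⟩ ?_)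
  rintro _ ⟨S, hS, rfl⟩
  have := hS.le_mul_card cyclePacking isCycle_cyclePacking card_filter_mem_cyclePacking_le
  omega

theorem nu_le : nu (fun x y => adj x y = true) ≤ 7 := by
  refine csSup_le' ?_
  rintro n ⟨C, hC, hdisj⟩
  have := mul_le_card_of_disjoint_cycleArcs two_le_card_inter_doubleTransversal C hC hdisj
  have hcard : doubleTransversal.card = 15 := by decide
  omega

end IsaakTournament

open IsaakTournament in
/-- Negative answer to Isaak's question (Problem 15.4.2 of Bang-Jensen–Gutin):
there is a tournament `T` with a minimum feedback arc set `S` inducing an acyclic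
digraph with a Hamiltonian directed path (through all endpoints of arcs of `S`),
and yet `ν(T) < τ(T)`. -/
theorem isaak_problem_negative_answer :
    ∃ (n : ℕ) (Adj : Fin n → Fin n → Bool),
      (∀ x, Adj x x = false) ∧
      (∀ x y : Fin n, x ≠ y → Adj x y = !(Adj y x)) ∧
      ∃ S : Finset (Fin n × Fin n),
        IsFeedbackArcSet (fun x y => Adj x y = true) S ∧
        S.card = tau (fun x y => Adj x y = true) ∧
        (∀ c : List (Fin n), ¬ IsCycle (fun x y : Fin n => (x, y) ∈ S) c) ∧
        (∃ p : List (Fin n), p.Nodup ∧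
          List.Chain' (fun x y : Fin n => (x, y) ∈ S) p ∧
          ∀ v : Fin n, ((∃ e ∈ S, e.1 = v ∨ e.2 = v) ↔ v ∈ p)) ∧
        nu (fun x y => Adj x y = true) < tau (fun x y => Adj x y = true) := by
  refine ⟨10, adj, by decide +kernel, by decide +kernel, backArcs, isFeedbackArcSet_backArcs,
    tau_eq.symm ▸ rfl, not_isCycle_of_lt (fun v => 10 - v.val) (by decide +kernel),
    ⟨[9, 7, 5, 3, 0], by decide, ?_, by decide +kernel⟩, ?_⟩
  · unfold List.Chain'
    decide
  · rw [tau_eq]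
    exact Nat.lt_succ_of_le nu_le
end

section
/- Let T be the tournament on the vertex set Fin 13 = {0,…,12} defined as follows: for i < j the arc goes from i to j, except for the pairs B = {(2,0),(4,2),(6,4),(8,6),(10,8),(12,10),(6,0),(8,2),(10,4),(12,6),(8,0),(12,4)}, for which the arc goes backward, i.e. (j,i) ∈ B means the arc is from j to i. Then τ(T) = 12, i.e. every feedback arc set of T has at least 12 arcs, and the 12-element set B itself is a feedback arc set of T. -/
/-- The backward arcs of the tournament `T` of Figure 1. -/
def B13 : Finset (Fin 13 × Fin 13) :=
  {(2,0),(4,2),(6,4),(8,6),(10,8),(12,10),(6,0),(8,2),(10,4),(12,6),(8,0),(12,4)}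

/-- The tournament `T` of Figure 1: for `i < j` the arc goes from `i` to `j`,
except for the pairs in `B13`, for which the arc goes backward. -/
def T13 (i j : Fin 13) : Prop :=
  (i < j ∧ (j, i) ∉ B13) ∨ (i, j) ∈ B13

/-- Weak duality between fractional packing and covering: if `S` meets every `E i`, and
each element lies in members of the family of total weight at most `k`, then the total
weight of the family is at most `k * S.card`. -/
theorem sum_weight_le_mul_card_of_hits {ι α : Type*} [Fintype ι] [DecidableEq α]
    (E : ι → Finset α) (w : ι → ℕ) (k : ℕ) (S : Finset α)
    (hit : ∀ i, ∃ e ∈ S, e ∈ E i)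
    (cap : ∀ e, ∑ i, (if e ∈ E i then w i else 0) ≤ k) :
    ∑ i, w i ≤ k * S.card := by
  calc ∑ i, w i ≤ ∑ i, ∑ e ∈ S, (if e ∈ E i then w i else 0) := by
        refine Finset.sum_le_sum fun i _ => ?_
        obtain ⟨e, heS, hei⟩ := hit i
        have := Finset.single_le_sum (f := fun e => if e ∈ E i then w i else 0)
          (fun _ _ => Nat.zero_le _) heS
        simpa [hei] using this
    _ = ∑ e ∈ S, ∑ i, (if e ∈ E i then w i else 0) := Finset.sum_comm
    _ ≤ ∑ _e ∈ S, k := Finset.sum_le_sum fun e _ => cap e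
    _ = k * S.card := by rw [Finset.sum_const, smul_eq_mul, mul_comm]

/-- The set of arcs of the triangle `a → b → c → a`. -/
def triangleArcs {V : Type*} [DecidableEq V] (t : V × V × V) : Finset (V × V) :=
  {(t.1, t.2.1), (t.2.1, t.2.2), (t.2.2, t.1)}

/-- A feedback arc set contains an arc of every directed triangle. -/
theorem IsFeedbackArcSet.exists_mem_triangleArcs {V : Type*} [DecidableEq V]
    {A : V → V → Prop} {S : Finset (V × V)} (hS : IsFeedbackArcSet A S) {a b c : V}
    (hd : [a, b, c].Nodup) (hab : A a b) (hbc : A b c) (hca : A c a) :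
    ∃ e ∈ S, e ∈ triangleArcs (a, b, c) := by
  by_contra! h
  have hnot : ∀ e ∈ triangleArcs (a, b, c), e ∉ S := fun e he heS => h e heS he
  simp only [triangleArcs, Finset.mem_insert, Finset.mem_singleton, forall_eq_or_imp,
    forall_eq] at hnot
  obtain ⟨h₁, h₂, h₃⟩ := hnot
  refine hS.2 [a, b, c] ⟨hd, by simp, ?_, fun _ => ?_⟩
  · exact List.isChain_cons_cons.mpr ⟨⟨hab, h₁⟩, List.isChain_pair.mpr ⟨hbc, h₂⟩⟩
  · exact ⟨hca, h₃⟩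

/-- An increasing relation has no directed cycle. -/
theorem not_isCycle_of_forall_lt {V : Type*} [Preorder V] {A : V → V → Prop}
    (hA : ∀ x y, A x y → x < y) (c : List V) : ¬ IsCycle A c := by
  rintro ⟨-, hlen, hchain, hclose⟩
  match c, hlen with
  | a :: l, hlen =>
    have hl : l ≠ [] := by rintro rfl; simp at hlen
    have hsorted : (a :: l).Pairwise (· < ·) :=
      List.isChain_iff_pairwise.mp (hchain.imp hA)
    have hlt : a < l.getLast hl :=
      (List.pairwise_cons.mp hsorted).1 _ (List.getLast_mem hl)
    have hback := hA _ _ (hclose (List.cons_ne_nil a l))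
    rw [List.getLast_cons hl, List.head_cons] at hback
    exact lt_asymm hlt hback

instance : DecidableRel T13 := fun i j =>
  inferInstanceAs (Decidable ((i < j ∧ (j, i) ∉ B13) ∨ (i, j) ∈ B13))

/-- The directed triangles of an optimal fractional triangle packing of `T13`. -/
def packedTriangle : Fin 19 → Fin 13 × Fin 13 × Fin 13 :=
  ![(0, 1, 2), (0, 3, 6), (0, 4, 8), (2, 3, 8), (2, 5, 8), (2, 3, 4), (4, 5, 6),
    (4, 7, 12), (0, 5, 8), (0, 5, 6), (6, 7, 8), (6, 9, 12), (4, 5, 10), (0, 3, 8),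
    (2, 6, 4), (8, 9, 10), (4, 7, 10), (4, 8, 12), (10, 11, 12)]

/-- Three times the weights of the fractional packing `packedTriangle`. -/
def packingWeight : Fin 19 → ℕ :=
  ![3, 2, 1, 1, 2, 2, 2, 1, 1, 1, 3, 3, 1, 1, 1, 3, 2, 2, 3]

theorem packedTriangle_isDirected : ∀ i : Fin 19,
    [(packedTriangle i).1, (packedTriangle i).2.1, (packedTriangle i).2.2].Nodup ∧
      T13 (packedTriangle i).1 (packedTriangle i).2.1 ∧
      T13 (packedTriangle i).2.1 (packedTriangle i).2.2 ∧
      T13 (packedTriangle i).2.2 (packedTriangle i).1 := by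
  decide +kernel

theorem sum_packingWeight : ∑ i, packingWeight i = 35 := by
  decide +kernel

theorem packingWeight_le_capacity : ∀ e : Fin 13 × Fin 13,
    ∑ i, (if e ∈ triangleArcs (packedTriangle i) then packingWeight i else 0) ≤ 3 := by
  decide +kernel

/-- `τ(T) = 12`: every feedback arc set of `T` has at least 12 arcs, and the
12-element set `B13` itself is a feedback arc set of `T`. -/
theorem tau_T13_eq_twelve :
    (∀ S : Finset (Fin 13 × Fin 13), IsFeedbackArcSet T13 S → 12 ≤ S.card) ∧
    IsFeedbackArcSet T13 B13 ∧ B13.card = 12 := by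
  refine ⟨fun S hS => ?_, ⟨fun e he => Or.inr he, ?_⟩, by decide⟩
  · have h := sum_weight_le_mul_card_of_hits (fun i => triangleArcs (packedTriangle i))
      packingWeight 3 S
      (fun i => by
        obtain ⟨hd, hab, hbc, hca⟩ := packedTriangle_isDirected i
        exact hS.exists_mem_triangleArcs hd hab hbc hca)
      packingWeight_le_capacity
    rw [sum_packingWeight] at h
    omega
  · refine not_isCycle_of_forall_lt fun x y hxy => ?_
    exact (hxy.1.resolve_right hxy.2).1
end

section
/- For every tournament T on at most 6 vertices, the maximum number of pairwise arc-disjoint directed cycles equals the minimum size of a feedback arc set: ν(T) = τ(T). -/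
section Cycles

variable {V W : Type*}

lemma isChain_and_closing_iff (R : V → V → Prop) (a x : V) (l : List V) :
    ((a :: l).IsChain R ∧ R ((a :: l).getLast (List.cons_ne_nil a l)) x) ↔
      ∀ e ∈ (a :: l).zip (l ++ [x]), R e.1 e.2 := by
  induction l generalizing a with
  | nil => simp
  | cons b l ih =>
    have := ih b
    simp only [List.cons_append, List.zip_cons_cons, List.mem_cons, forall_eq_or_imp,
      List.isChain_cons_cons, List.getLast_cons_cons] at this ⊢
    rw [← this]
    tauto

lemma isCycle_iff [DecidableEq V] (A : V → V → Prop) (c : List V) :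
    IsCycle A c ↔ c.Nodup ∧ 3 ≤ c.length ∧ ∀ e ∈ cycleArcs c, A e.1 e.2 := by
  unfold IsCycle cycleArcs
  cases c with
  | nil => simp
  | cons a l =>
    have := isChain_and_closing_iff A a a l
    simp only [List.mem_toFinset, List.rotate_cons_succ, List.rotate_zero, List.head_cons] at this ⊢
    rw [← this]
    simp [List.Chain']

lemma mem_of_mem_cycleArcs [DecidableEq V] {c : List V} {e : V × V} (he : e ∈ cycleArcs c) :
    e.1 ∈ c ∧ e.2 ∈ c := by
  have h := List.of_mem_zip (a := e.1) (b := e.2) (List.mem_toFinset.1 he)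
  simpa using h

lemma exists_mem_cycleArcs [DecidableEq V] {c : List V} {x : V} (hx : x ∈ c) :
    ∃ y, (x, y) ∈ cycleArcs c := by
  obtain ⟨i, hi, rfl⟩ := List.mem_iff_getElem.1 hx
  have hi' : i < (c.rotate 1).length := by simpa using hi
  refine ⟨(c.rotate 1)[i], List.mem_toFinset.2 (List.mem_iff_getElem.2 ⟨i, ?_, ?_⟩)⟩
  · simpa using hi
  · simp

lemma cycleArcs_map [DecidableEq V] [DecidableEq W] (f : V → W) (c : List V) :
    cycleArcs (c.map f) = (cycleArcs c).image (Prod.map f f) := by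
  unfold cycleArcs
  rw [← List.map_rotate, List.zip_map]
  ext e
  simp

/-- A digraph in which every arc increases some rank function has no cycle. -/
lemma not_isCycle_of_rank (A : V → V → Prop) (g : V → ℕ) (hg : ∀ x y, A x y → g x < g y)
    (c : List V) : ¬ IsCycle A c := by
  classical
  intro h
  rw [isCycle_iff] at h
  have hne : c.toFinset.Nonempty := by
    rw [List.toFinset_nonempty_iff]
    rintro rfl
    simp at h
  obtain ⟨x, hx, hmax⟩ := c.toFinset.exists_max_image g hne
  obtain ⟨y, hy⟩ := exists_mem_cycleArcs (List.mem_toFinset.1 hx)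
  have := hg x y (h.2.2 _ hy)
  have := hmax y (List.mem_toFinset.2 (mem_of_mem_cycleArcs hy).2)
  omega

/-- Arc-disjoint cycles meet a feedback arc set in distinct arcs. -/
lemma card_cycles_le_card_feedbackArcSet [DecidableEq V] {A : V → V → Prop} {S : Finset (V × V)}
    (hS : IsFeedbackArcSet A S) {n : ℕ} {C : Fin n → List V} (hC : ∀ i, IsCycle A (C i))
    (hd : ∀ i j, i ≠ j → Disjoint (cycleArcs (C i)) (cycleArcs (C j))) : n ≤ S.card := by
  have hmeet : ∀ i, ∃ e ∈ S, e ∈ cycleArcs (C i) := by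
    intro i
    by_contra! hcon
    refine hS.2 (C i) ?_
    have := hC i
    rw [isCycle_iff] at this ⊢
    exact ⟨this.1, this.2.1, fun e he => ⟨this.2.2 e he, fun heS => hcon e heS he⟩⟩
  choose g hgS hgC using hmeet
  have hinj : Function.Injective g := by
    intro i j hij
    by_contra hne
    exact Finset.disjoint_left.1 (hd i j hne) (hgC i) (hij ▸ hgC j)
  simpa using Finset.card_le_card_of_injOn (s := Finset.univ) g (fun i _ => hgS i) hinj.injOn

lemma nu_eq_tau_of_packing [DecidableEq V] {A : V → V → Prop} {S : Finset (V × V)}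
    (hS : IsFeedbackArcSet A S) {n : ℕ} (hSn : S.card ≤ n) {C : Fin n → List V}
    (hC : ∀ i, IsCycle A (C i))
    (hd : ∀ i j, i ≠ j → Disjoint (cycleArcs (C i)) (cycleArcs (C j))) : nu A = tau A := by
  obtain ⟨S', hS', hcard⟩ := Nat.sInf_mem
    (s := {n | ∃ S : Finset (V × V), IsFeedbackArcSet A S ∧ S.card = n}) ⟨_, S, hS, rfl⟩
  apply le_antisymm
  · refine csSup_le' ?_
    rintro m ⟨C', hC', hd'⟩
    exact (card_cycles_le_card_feedbackArcSet hS' hC' hd').trans hcard.le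
  · calc tau A ≤ S.card := Nat.sInf_le ⟨S, hS, rfl⟩
      _ ≤ n := hSn
      _ ≤ nu A := by
        refine le_csSup ⟨S.card, ?_⟩ ⟨C, hC, hd⟩
        rintro m ⟨C', hC', hd'⟩
        exact card_cycles_le_card_feedbackArcSet hS hC' hd'

end Cycles

section BackCount

variable {V W : Type*}

/-- The number of arcs of `d` that go backwards with respect to the order of the list. -/
def backCount (d : V → V → Bool) : List V → ℕ
  | [] => 0
  | x :: l => l.countP (fun y => d y x) + backCount d l

lemma backCount_map (d : W → W → Bool) (f : V → W) (l : List V) :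
    backCount d (l.map f) = backCount (fun x y => d (f x) (f y)) l := by
  induction l with
  | nil => rfl
  | cons x l ih => simp [backCount, ih, List.countP_map, Function.comp_def]

lemma backCount_congr {d d' : V → V → Bool} {l : List V}
    (h : ∀ x ∈ l, ∀ y ∈ l, d x y = d' x y) : backCount d l = backCount d' l := by
  induction l with
  | nil => rfl
  | cons x l ih =>
    rw [backCount, backCount, ih fun y hy z hz => h y (by simp [hy]) z (by simp [hz])]
    congr 1
    exact List.countP_congr fun y hy => by rw [h y (by simp [hy]) x (by simp)]

lemma List.Sublist.backCount_le (d : V → V → Bool) {l l' : List V} (h : l.Sublist l') :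
    backCount d l ≤ backCount d l' := by
  induction h with
  | slnil => exact le_rfl
  | cons x _ ih => exact ih.trans (Nat.le_add_left _ _)
  | cons_cons x h ih => exact Nat.add_le_add h.countP_le ih

lemma backCount_concat (d : V → V → Bool) (l : List V) (y : V) (h : ∀ x ∈ l, d y x = false) :
    backCount d (l ++ [y]) = backCount d l := by
  induction l with
  | nil => rfl
  | cons x l ih =>
    simp only [List.cons_append, backCount]
    rw [ih fun z hz => h z (by simp [hz])]
    simp [h x (by simp)]

lemma backCount_swap_lt (d : V → V → Bool) (l₁ l₂ : List V) {x y : V}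
    (hyx : d y x = true) (hxy : d x y = false) :
    backCount d (l₁ ++ y :: x :: l₂) < backCount d (l₁ ++ x :: y :: l₂) := by
  induction l₁ with
  | nil =>
    simp only [List.nil_append, backCount, List.countP_cons, hyx, hxy]
    simp
    omega
  | cons z l ih =>
    simp only [List.cons_append, backCount]
    have : (l ++ y :: x :: l₂).countP (fun w => d w z) =
        (l ++ x :: y :: l₂).countP (fun w => d w z) :=
      List.Perm.countP_eq _ ((List.Perm.swap x y l₂).append_left l)
    omega

end BackCount

section SixVertices

/-- The pairs of non-consecutive positions `i < j` among six. -/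
def nonconsecutivePairs : List (ℕ × ℕ) :=
  [(0, 2), (0, 3), (0, 4), (0, 5), (1, 3), (1, 4), (1, 5), (2, 4), (2, 5), (3, 5)]

/-- The tournament on `ℕ` whose arcs increase, except for those joining a pair listed in `B`. -/
def arcWithBack (B : List (ℕ × ℕ)) (i j : ℕ) : Bool :=
  bif Nat.blt i j then !B.contains (i, j) else B.contains (j, i)

/-- Completes each pair `i < j` of a list to a cycle of `arcWithBack B` by an increasing path from
`i` to `j`, so that the paths are arc-disjoint and avoid the arcs in `used`. -/
def findPacking (B : List (ℕ × ℕ)) : List (ℕ × ℕ) → List (ℕ × ℕ) → Option (List (List ℕ))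
  | [], _ => some []
  | e :: es, used =>
    (List.range' (e.1 + 1) (e.2 - e.1 - 1)).sublists.findSome? fun m =>
      let c := e.1 :: (m ++ [e.2])
      let arcs := c.zip c.tail
      bif arcs.all fun a => !B.contains a && !used.contains a then
        (findPacking B es (arcs ++ used)).map (c :: ·)
      else none

/-- `P` is a list of `B.length` arc-disjoint cycles of `arcWithBack B`, each of them bounded by an
end of some pair in `B`. -/
def IsPacking (B : List (ℕ × ℕ)) (P : List (List ℕ)) : Prop :=
  P.length = B.length ∧
    (∀ c ∈ P, (∃ e ∈ B, ∀ x ∈ c, x ≤ e.2) ∧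
      c.Nodup ∧ 3 ≤ c.length ∧ ∀ e ∈ cycleArcs c, arcWithBack B e.1 e.2 = true) ∧
    P.Pairwise fun c c' => Disjoint (cycleArcs c) (cycleArcs c')

instance (B : List (ℕ × ℕ)) (P : List (List ℕ)) : Decidable (IsPacking B P) := by
  unfold IsPacking
  infer_instance

/-- Orders of six positions, at least one of which improves on the identity order whenever the
backward arcs of the latter do not extend to arc-disjoint cycles. -/
def improvingOrders : List (List ℕ) :=
  [[3, 4, 5, 0, 1, 2], [0, 1, 4, 2, 5, 3], [1, 2, 3, 0, 4, 5], [2, 0, 3, 4, 5, 1],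
   [0, 1, 5, 2, 3, 4], [0, 1, 3, 4, 5, 2], [3, 0, 1, 2, 4, 5], [1, 2, 3, 4, 5, 0],
   [0, 4, 1, 2, 3, 5], [5, 0, 1, 2, 3, 4], [2, 0, 3, 1, 4, 5], [0, 2, 3, 4, 1, 5],
   [0, 3, 1, 4, 2, 5], [4, 0, 1, 2, 5, 3], [0, 2, 4, 5, 1, 3], [0, 2, 5, 3, 1, 4],
   [0, 3, 5, 1, 2, 4], [1, 2, 4, 0, 5, 3], [1, 2, 5, 0, 3, 4], [1, 3, 4, 0, 2, 5],
   [1, 4, 2, 0, 3, 5], [2, 4, 0, 1, 3, 5], [2, 0, 4, 1, 5, 3], [2, 0, 5, 1, 3, 4],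
   [2, 3, 4, 0, 5, 1], [3, 0, 4, 5, 1, 2], [3, 4, 0, 1, 5, 2], [4, 0, 5, 1, 2, 3]]

lemma perm_range_of_mem_improvingOrders :
    ∀ p ∈ improvingOrders, p.Perm (List.range 6) := by
  decide +kernel

lemma improvingOrders_or_isPacking : ∀ B ∈ nonconsecutivePairs.sublists,
    (∃ p ∈ improvingOrders,
      backCount (arcWithBack B) p < backCount (arcWithBack B) (List.range 6)) ∨
    IsPacking B ((findPacking B B []).getD []) := by
  decide +kernel

lemma arcWithBack_of_lt {B : List (ℕ × ℕ)} {i j : ℕ} (h : i < j) :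
    arcWithBack B i j = !decide ((i, j) ∈ B) ∧ arcWithBack B j i = decide ((i, j) ∈ B) := by
  have h₁ : Nat.blt i j = true := by simpa using h
  have h₂ : Nat.blt j i = false := by
    rw [← Bool.not_eq_true, Nat.blt_eq]
    omega
  simp [arcWithBack, h₁, h₂]

lemma arcWithBack_self (B : List (ℕ × ℕ)) (i : ℕ) :
    arcWithBack B i i = decide ((i, i) ∈ B) := by
  have h : Nat.blt i i = false := by
    rw [← Bool.not_eq_true, Nat.blt_eq]
    omega
  simp [arcWithBack, h]

lemma backCount_arcWithBack_range {B : List (ℕ × ℕ)} {n m : ℕ} (hB : ∀ e ∈ B, e.2 < n)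
    (hnm : n ≤ m) :
    backCount (arcWithBack B) (List.range m) = backCount (arcWithBack B) (List.range n) := by
  induction m, hnm using Nat.le_induction with
  | base => rfl
  | succ m hnm ih =>
    rw [List.range_succ, backCount_concat, ih]
    intro x hx
    rw [(arcWithBack_of_lt (List.mem_range.1 hx)).2, decide_eq_false_iff_not]
    intro hmem
    have := hB _ hmem
    simp only at this
    omega

end SixVertices

section Tournament

variable {V : Type*}

lemma exists_minimal_order [Fintype V] (d : V → V → Bool) :
    ∃ L : List V, L.Nodup ∧ (∀ x, x ∈ L) ∧
      ∀ L' : List V, L'.Perm L → backCount d L ≤ backCount d L' := by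
  let L₀ : List V := Finset.univ.toList
  obtain ⟨L, hL, hmin⟩ := (measure (backCount d)).wf.has_min {L | L.Perm L₀} ⟨L₀, .refl _⟩
  refine ⟨L, hL.nodup_iff.2 (Finset.nodup_toList _), fun x => hL.mem_iff.2 (by simp [L₀]),
    fun L' hL' => ?_⟩
  exact not_lt.1 (hmin L' (hL'.trans hL))

/-- The pairs of non-consecutive positions that carry a backward arc of `d` in the order `L`. -/
def backPairs [Inhabited V] (d : V → V → Bool) (L : List V) : List (ℕ × ℕ) :=
  nonconsecutivePairs.filter fun e => decide (e.2 < L.length) &&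
    d (L.getD e.2 default) (L.getD e.1 default)

variable [Inhabited V] {d : V → V → Bool} {L : List V}

lemma lt_of_mem_backPairs {e : ℕ × ℕ} (he : e ∈ backPairs d L) : e.1 < e.2 ∧ e.2 < L.length := by
  simp only [backPairs, List.mem_filter, Bool.and_eq_true, decide_eq_true_eq] at he
  have : ∀ e ∈ nonconsecutivePairs, e.1 < e.2 := by decide
  exact ⟨this e he.1, he.2.1⟩

lemma mem_backPairs_iff (hlen : L.length ≤ 6)
    (hanti : ∀ x y, d x y = true → d y x = false)
    (hmin : ∀ L' : List V, L'.Perm L → backCount d L ≤ backCount d L')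
    {i j : ℕ} (hij : i < j) (hj : j < L.length) :
    (i, j) ∈ backPairs d L ↔ d (L.getD j default) (L.getD i default) = true := by
  simp only [backPairs, List.mem_filter, Bool.and_eq_true, decide_eq_true_eq, hj, true_and,
    and_iff_right_iff_imp]
  intro hd
  have hpairs : ∀ i j : Fin 6, i.val + 1 < j.val → (i.val, j.val) ∈ nonconsecutivePairs := by
    decide
  refine hpairs ⟨i, by omega⟩ ⟨j, by omega⟩ (lt_of_le_of_ne hij fun hne => ?_)
  obtain rfl : i + 1 = j := hne
  have hi : i < L.length := by omega
  rw [List.getD_eq_getElem _ _ hj, List.getD_eq_getElem _ _ hi] at hd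
  have hL : L = L.take i ++ L[i] :: L[i + 1] :: L.drop (i + 1 + 1) := by
    rw [← List.drop_eq_getElem_cons hj, ← List.drop_eq_getElem_cons hi, List.take_append_drop]
  have hlt := backCount_swap_lt d (L.take i) (L.drop (i + 1 + 1)) hd (hanti _ _ hd)
  rw [← hL] at hlt
  refine absurd (hmin _ ?_) (not_le.2 hlt)
  conv_rhs => rw [hL]
  exact (List.Perm.swap _ _ _).append_left _

lemma arcWithBack_backPairs (hlen : L.length ≤ 6) (hnodup : L.Nodup)
    (hirr : ∀ x, d x x = false) (htour : ∀ x y, x ≠ y → d x y = !d y x)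
    (hmin : ∀ L' : List V, L'.Perm L → backCount d L ≤ backCount d L')
    {i j : ℕ} (hi : i < L.length) (hj : j < L.length) :
    arcWithBack (backPairs d L) i j = d (L.getD i default) (L.getD j default) := by
  have hanti : ∀ x y, d x y = true → d y x = false := by
    intro x y hxy
    have hne : x ≠ y := by
      rintro rfl
      simp [hirr] at hxy
    simpa [hxy] using htour x y hne
  have hback : ∀ {i j : ℕ}, i < j → j < L.length →
      decide ((i, j) ∈ backPairs d L) = d (L.getD j default) (L.getD i default) := by
    intro i j hij hj
    rw [Bool.eq_iff_iff, decide_eq_true_eq, mem_backPairs_iff hlen hanti hmin hij hj]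
  rcases lt_trichotomy i j with hij | rfl | hij
  · rw [(arcWithBack_of_lt hij).1, hback hij hj, ← htour]
    rw [List.getD_eq_getElem _ _ hj, List.getD_eq_getElem _ _ hi]
    intro h
    exact hij.ne (hnodup.getElem_inj_iff.1 h)
  · have : (i, i) ∉ backPairs d L := fun h => lt_irrefl _ (lt_of_mem_backPairs h).1
    rw [arcWithBack_self, hirr, decide_eq_false this]
  · rw [(arcWithBack_of_lt hij).2, hback hij hi]

lemma backCount_range_le_of_perm (hlen : L.length ≤ 6)
    (hmin : ∀ L' : List V, L'.Perm L → backCount d L ≤ backCount d L')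
    (harc : ∀ i < L.length, ∀ j < L.length,
      arcWithBack (backPairs d L) i j = d (L.getD i default) (L.getD j default))
    {p : List ℕ} (hp : p.Perm (List.range 6)) :
    backCount (arcWithBack (backPairs d L)) (List.range 6) ≤
      backCount (arcWithBack (backPairs d L)) p := by
  let f : ℕ → V := fun i => L.getD i default
  let q := p.filter (· < L.length)
  have hq : q.Perm (List.range L.length) := by
    rw [List.perm_ext_iff_of_nodup ((hp.nodup_iff.2 List.nodup_range).filter _) List.nodup_range]
    intro i
    simp only [List.mem_filter, hp.mem_iff, List.mem_range, decide_eq_true_eq]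
    omega
  have hmap : (List.range L.length).map f = L := by
    apply List.ext_getElem
    · simp
    · intro i _ hi
      simp [f, hi]
  have hcount : ∀ l : List ℕ, (∀ i ∈ l, i < L.length) →
      backCount (arcWithBack (backPairs d L)) l = backCount d (l.map f) := by
    intro l hl
    rw [backCount_map]
    exact backCount_congr fun i hi j hj => harc i (hl i hi) j (hl j hj)
  calc backCount (arcWithBack (backPairs d L)) (List.range 6)
      = backCount (arcWithBack (backPairs d L)) (List.range L.length) :=
        backCount_arcWithBack_range (fun e he => (lt_of_mem_backPairs he).2) hlen
    _ = backCount d L := by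
        rw [hcount _ fun i hi => List.mem_range.1 hi, hmap]
    _ ≤ backCount d (q.map f) := hmin _ (by simpa only [hmap] using hq.map f)
    _ = backCount (arcWithBack (backPairs d L)) q :=
        (hcount q fun i hi => List.mem_range.1 (hq.mem_iff.1 hi)).symm
    _ ≤ backCount (arcWithBack (backPairs d L)) p := List.filter_sublist.backCount_le _

lemma isFeedbackArcSet_backPairs [DecidableEq V] (hmem : ∀ x, x ∈ L)
    (harc : ∀ i < L.length, ∀ j < L.length,
      arcWithBack (backPairs d L) i j = d (L.getD i default) (L.getD j default)) :
    IsFeedbackArcSet (fun x y => d x y = true)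
      ((backPairs d L).map fun e => (L.getD e.2 default, L.getD e.1 default)).toFinset := by
  have hget : ∀ x, L.idxOf x < L.length ∧ L.getD (L.idxOf x) default = x := by
    intro x
    have hx := List.idxOf_lt_length_of_mem (hmem x)
    exact ⟨hx, by rw [List.getD_eq_getElem _ _ hx, List.getElem_idxOf]⟩
  constructor
  · intro e he
    simp only [List.mem_toFinset, List.mem_map] at he
    obtain ⟨b, hb, rfl⟩ := he
    have hlt := lt_of_mem_backPairs hb
    rw [← harc _ hlt.2 _ (hlt.1.trans hlt.2), (arcWithBack_of_lt hlt.1).2]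
    simpa using hb
  · refine not_isCycle_of_rank _ (fun x => L.idxOf x) ?_
    rintro x y ⟨hxy, hS⟩
    by_contra hle
    have hix := hget x
    have hiy := hget y
    rw [← hix.2, ← hiy.2, ← harc _ hix.1 _ hiy.1] at hxy
    rcases (not_lt.1 hle).lt_or_eq with hlt | heq
    · rw [(arcWithBack_of_lt hlt).2, decide_eq_true_eq] at hxy
      refine hS (List.mem_toFinset.2 (List.mem_map.2 ⟨_, hxy, ?_⟩))
      rw [hix.2, hiy.2]
    · rw [show L.idxOf y = L.idxOf x from heq] at hxy
      have : (L.idxOf x, L.idxOf x) ∉ backPairs d L :=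
        fun h => lt_irrefl _ (lt_of_mem_backPairs h).1
      rw [arcWithBack_self, decide_eq_false this] at hxy
      exact Bool.false_ne_true hxy

lemma nu_eq_tau_of_isPacking [DecidableEq V] (hnodup : L.Nodup) (hmem : ∀ x, x ∈ L)
    (harc : ∀ i < L.length, ∀ j < L.length,
      arcWithBack (backPairs d L) i j = d (L.getD i default) (L.getD j default))
    {P : List (List ℕ)} (hP : IsPacking (backPairs d L) P) :
    nu (fun x y => d x y = true) = tau (fun x y => d x y = true) := by
  obtain ⟨hPlen, hcyc, hdisj⟩ := hP
  let f : ℕ → V := fun i => L.getD i default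
  have hlt : ∀ c ∈ P, ∀ i ∈ c, i < L.length := by
    intro c hc i hi
    obtain ⟨e, he, hle⟩ := (hcyc c hc).1
    exact (hle i hi).trans_lt (lt_of_mem_backPairs he).2
  have hinj : ∀ i < L.length, ∀ j < L.length, f i = f j → i = j := by
    intro i hi j hj h
    simp only [f, List.getD_eq_getElem _ _ hi, List.getD_eq_getElem _ _ hj] at h
    exact hnodup.getElem_inj_iff.1 h
  refine nu_eq_tau_of_packing (isFeedbackArcSet_backPairs hmem harc)
    (n := P.length) ?_ (C := fun k => (P.get k).map f) ?_ ?_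
  · refine (List.toFinset_card_le _).trans ?_
    rw [List.length_map, hPlen]
  · intro k
    have hk := List.get_mem P k
    obtain ⟨-, hnd, hlen, harcs⟩ := hcyc _ hk
    rw [isCycle_iff]
    refine ⟨hnd.map_on fun i hi j hj => hinj i (hlt _ hk i hi) j (hlt _ hk j hj),
      by simpa using hlen, ?_⟩
    rw [cycleArcs_map]
    intro e he
    obtain ⟨b, hb, rfl⟩ := Finset.mem_image.1 he
    have hb' := mem_of_mem_cycleArcs hb
    have := harcs b hb
    rwa [harc _ (hlt _ hk _ hb'.1) _ (hlt _ hk _ hb'.2)] at this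
  · intro k l hkl
    have hd : Disjoint (cycleArcs (P.get k)) (cycleArcs (P.get l)) := by
      rw [List.pairwise_iff_get] at hdisj
      rcases lt_or_gt_of_ne hkl with h | h
      · exact hdisj _ _ h
      · exact (hdisj _ _ h).symm
    rw [cycleArcs_map, cycleArcs_map, Finset.disjoint_left]
    intro e he he'
    obtain ⟨b, hb, rfl⟩ := Finset.mem_image.1 he
    obtain ⟨b', hb', heq⟩ := Finset.mem_image.1 he'
    have hk := hlt _ (List.get_mem P k)
    have hl := hlt _ (List.get_mem P l)
    have hmb := mem_of_mem_cycleArcs hb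
    have hmb' := mem_of_mem_cycleArcs hb'
    have : b' = b := Prod.ext
      (hinj _ (hl _ hmb'.1) _ (hk _ hmb.1) (congrArg Prod.fst heq))
      (hinj _ (hl _ hmb'.2) _ (hk _ hmb.2) (congrArg Prod.snd heq))
    exact Finset.disjoint_left.1 hd hb (this ▸ hb')

end Tournament

/-- Remark 2 (first part): for every tournament on at most 6 vertices,
the maximum number of arc-disjoint cycles equals the minimum size of a
feedback arc set. -/
theorem nu_eq_tau_of_card_le_six {V : Type*} [Fintype V] [DecidableEq V]
    (A : V → V → Prop)
    (hirr : ∀ x, ¬ A x x)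
    (htour : ∀ x y : V, x ≠ y → (A x y ↔ ¬ A y x))
    (hcard : Fintype.card V ≤ 6) :
    nu A = tau A := by
  classical
  rcases isEmpty_or_nonempty V with hV | hV
  · refine nu_eq_tau_of_packing (S := ∅) (n := 0) (C := Fin.elim0) ?_ (by simp) (by simp) (by simp)
    exact ⟨by simp, not_isCycle_of_rank _ (fun _ => 0) fun x => isEmptyElim x⟩
  inhabit V
  let d : V → V → Bool := fun x y => decide (A x y)
  have hA : A = fun x y => d x y = true := by simp [d]
  have hd_irr : ∀ x, d x x = false := by simpa [d] using hirr
  have hd_tour : ∀ x y, x ≠ y → d x y = !d y x := by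
    intro x y hxy
    simp [d, htour x y hxy]
  obtain ⟨L, hnodup, hmem, hmin⟩ := exists_minimal_order d
  have hlen : L.length ≤ 6 := hnodup.length_le_card.trans hcard
  have harc : ∀ i < L.length, ∀ j < L.length,
      arcWithBack (backPairs d L) i j = d (L.getD i default) (L.getD j default) :=
    fun i hi j hj => arcWithBack_backPairs hlen hnodup hd_irr hd_tour hmin hi hj
  rw [hA]
  rcases improvingOrders_or_isPacking (backPairs d L)
    (List.mem_sublists.2 List.filter_sublist) with ⟨p, hp, hlt⟩ | hP
  · exact absurd hlt (not_lt.2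
      (backCount_range_le_of_perm hlen hmin harc (perm_range_of_mem_improvingOrders p hp)))
  · exact nu_eq_tau_of_isPacking hnodup hmem harc hP
end

section
/- Let T₁₁ be the tournament on the vertex set Fin 11 = {0,…,10} defined as follows: for i < j the arc goes from i to j, except for the pairs B₁₁ = {(2,0),(6,3),(9,7)} ∪ {(x,y) : x ∈ {7,8,9}, y ∈ {0,1,2}} ∪ {(10,y) : y ∈ {0,1,2,3,4}}, for which the arc goes backward. Then T₁₁ is eulerian (every vertex has out-degree equal to in-degree, both equal to 5), so every vertex has the minimum out-degree δ⁺(T₁₁) = 5, and yet the vertex 10 does not belong to 5 pairwise arc-disjoint 3-cycles: there is no family of 5 pairwise arc-disjoint directed 3-cycles each passing through vertex 10. -/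
/-- The backward arcs of the eulerian tournament `T₁₁` of Figure 3. -/
def B11 : Finset (Fin 11 × Fin 11) :=
  {(2,0),(6,3),(9,7)} ∪
    (({7,8,9} : Finset (Fin 11)) ×ˢ ({0,1,2} : Finset (Fin 11))) ∪
    (({10} : Finset (Fin 11)) ×ˢ ({0,1,2,3,4} : Finset (Fin 11)))

/-- The tournament `T₁₁` of Figure 3: for `i < j` the arc goes from `i` to `j`,
except for the pairs in `B11`, for which the arc goes backward. -/
def T11 (i j : Fin 11) : Prop :=
  (i < j ∧ (j, i) ∉ B11) ∨ (i, j) ∈ B11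

instance : DecidableRel T11 := fun _ _ => inferInstanceAs (Decidable (_ ∨ _))

/-- The arc set of the 3-cycle `v → x → y → v`. -/
def arcs3 (v x y : Fin 11) : Finset (Fin 11 × Fin 11) :=
  {(v, x), (x, y), (y, v)}

/-- A 3-cycle through `10` whose second vertex is `0`, `1` or `2` has third vertex `5` or `6`. -/
theorem third_mem_of_second_mem {x y : Fin 11} (hx : x ∈ ({0, 1, 2} : Finset (Fin 11)))
    (hxy : T11 x y) (hy : T11 y 10) : y ∈ ({5, 6} : Finset (Fin 11)) := by
  revert x y
  decide

/-- Arc-disjoint 3-cycles through `v` have distinct second and third vertices. -/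
theorem ne_of_disjoint_arcs3 {v x y x' y' : Fin 11}
    (h : Disjoint (arcs3 v x y) (arcs3 v x' y')) : x ≠ x' ∧ y ≠ y' := by
  constructor
  · rintro rfl
    exact Finset.disjoint_left.1 h (show (v, x) ∈ _ by simp [arcs3]) (by simp [arcs3])
  · rintro rfl
    exact Finset.disjoint_left.1 h (show (y, v) ∈ _ by simp [arcs3]) (by simp [arcs3])

/-- Remark 4: `T₁₁` is eulerian (every vertex has out-degree and in-degree 5,
hence every vertex has the minimum out-degree `δ⁺(T₁₁) = 5`), and yet the
vertex `10` does not belong to 5 pairwise arc-disjoint 3-cycles. -/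
theorem remark4_T11 :
    (∀ v : Fin 11,
      (Finset.univ.filter (fun u => T11 v u)).card = 5 ∧
      (Finset.univ.filter (fun u => T11 u v)).card = 5) ∧
    ¬ ∃ C : Fin 5 → Fin 11 × Fin 11,
        (∀ i, (C i).1 ≠ 10 ∧ (C i).2 ≠ 10 ∧ (C i).1 ≠ (C i).2 ∧
          T11 10 (C i).1 ∧ T11 (C i).1 (C i).2 ∧ T11 (C i).2 10) ∧
        ∀ i j, i ≠ j →
          Disjoint (arcs3 10 (C i).1 (C i).2) (arcs3 10 (C j).1 (C j).2) := by
  have degrees : ∀ v : Fin 11,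
      (Finset.univ.filter (fun u => T11 v u)).card = 5 ∧
      (Finset.univ.filter (fun u => T11 u v)).card = 5 := by decide
  refine ⟨degrees, ?_⟩
  rintro ⟨C, hC, hdisj⟩
  have hfst : Function.Injective fun i => (C i).1 := fun i j h =>
    by_contra fun hij => (ne_of_disjoint_arcs3 (hdisj i j hij)).1 h
  have hsnd : Function.Injective fun i => (C i).2 := fun i j h =>
    by_contra fun hij => (ne_of_disjoint_arcs3 (hdisj i j hij)).2 h
  have himage : Finset.univ.image (fun i => (C i).1) = Finset.univ.filter (fun u => T11 10 u) := by
    refine Finset.eq_of_subset_of_card_le ?_ ?_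
    · intro x hx
      obtain ⟨i, -, rfl⟩ := Finset.mem_image.1 hx
      simpa using (hC i).2.2.2.1
    · rw [Finset.card_image_of_injective _ hfst, (degrees 10).1]
      simp
  let S : Finset (Fin 5) := Finset.univ.filter fun i => (C i).1 ∈ ({0, 1, 2} : Finset (Fin 11))
  have hlower : ({0, 1, 2} : Finset (Fin 11)) ⊆ S.image fun i => (C i).1 := by
    intro x hx
    have hout : x ∈ Finset.univ.filter (fun u => T11 10 u) := by
      revert x
      decide
    rw [← himage] at hout
    obtain ⟨i, -, rfl⟩ := Finset.mem_image.1 hout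
    exact Finset.mem_image_of_mem _ (Finset.mem_filter.2 ⟨Finset.mem_univ i, hx⟩)
  have hupper : (S.image fun i => (C i).2) ⊆ ({5, 6} : Finset (Fin 11)) := by
    intro y hy
    obtain ⟨i, hi, rfl⟩ := Finset.mem_image.1 hy
    exact third_mem_of_second_mem (Finset.mem_filter.1 hi).2 (hC i).2.2.2.2.1 (hC i).2.2.2.2.2
  have hthree : 3 ≤ S.card := (Finset.card_le_card hlower).trans Finset.card_image_le
  have htwo : S.card ≤ 2 := by
    rw [← Finset.card_image_of_injective S hsnd]
    exact Finset.card_le_card hupper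
  omega
end
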